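/- arXiv:1902.03017 — 5 statements merged into one kernel-verified Lean document; each statement's English description precedes it below -/
import Mathlib

section
/- A nontrivial finite simple connected graph G satisfies dim_ms(G) = 1 if and only if G is a path graph (a graph isomorphic to P_n for some n ≥ 2). -/
/-- The multiset representation of `u` with respect to `S`: the multiset of
graph distances from `u` to the elements of `S`, counted with multiplicity. -/
noncomputable def mrep {V : Type*} (G : SimpleGraph V) (u : V) (S : Finset V) : Multiset ℕ :=
  S.val.map (G.dist u)

/-- `S` is an outer multiset resolving set of `G`. -/
def outerMResolving {V : Type*} (G : SimpleGraph V) (S : Finset V) : Prop :=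
  ∀ u v : V, u ∉ S → v ∉ S → mrep G u S = mrep G v S → u = v

/-- The outer multiset dimension of `G`. -/
noncomputable def dimMS {V : Type*} [Fintype V] (G : SimpleGraph V) : ℕ :=
  sInf {k | ∃ S : Finset V, outerMResolving G S ∧ S.card = k}

theorem outerMResolving_singleton_iff {V : Type*} {G : SimpleGraph V} (hG : G.Connected) (w : V) :
    outerMResolving G {w} ↔ Function.Injective fun u => G.dist u w := by
  constructor
  · intro h u v huv
    simp only at huv
    by_cases hu : u = w
    · subst hu
      rw [G.dist_self, eq_comm, hG.dist_eq_zero_iff] at huv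
      exact huv.symm
    · by_cases hv : v = w
      · subst hv
        rw [G.dist_self, hG.dist_eq_zero_iff] at huv
        exact huv
      · exact h u v (by simpa using hu) (by simpa using hv) (by simpa [mrep] using huv)
  · intro h u v _ _ huv
    exact h (by simpa [mrep] using huv)

theorem not_outerMResolving_empty {V : Type*} [Nontrivial V] (G : SimpleGraph V) :
    ¬ outerMResolving G ∅ := by
  intro h
  obtain ⟨u, v, huv⟩ := exists_pair_ne V
  exact huv (h u v (by simp) (by simp) (by simp [mrep]))

theorem dimMS_eq_one_iff_exists_injective_dist {V : Type*} [Fintype V] [Nontrivial V]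
    {G : SimpleGraph V} (hG : G.Connected) :
    dimMS G = 1 ↔ ∃ w, Function.Injective fun u => G.dist u w := by
  constructor
  · intro h
    obtain ⟨S, hS, hcard⟩ := Nat.sInf_mem (Nat.nonempty_of_sInf_eq_succ h)
    obtain ⟨w, rfl⟩ := Finset.card_eq_one.mp (hcard.trans h)
    exact ⟨w, (outerMResolving_singleton_iff hG w).mp hS⟩
  · rintro ⟨w, hw⟩
    have hmem : 1 ∈ {k | ∃ S : Finset V, outerMResolving G S ∧ S.card = k} :=
      ⟨{w}, (outerMResolving_singleton_iff hG w).mpr hw, Finset.card_singleton w⟩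
    refine le_antisymm (Nat.sInf_le hmem) (Nat.one_le_iff_ne_zero.mpr fun h0 => ?_)
    obtain ⟨S, hS, hcard⟩ := Nat.sInf_mem ⟨1, hmem⟩
    obtain rfl := Finset.card_eq_zero.mp (hcard.trans h0)
    exact not_outerMResolving_empty G hS

namespace SimpleGraph

theorem Connected.dist_lt_card {V : Type*} [Fintype V] {G : SimpleGraph V} (hG : G.Connected)
    (u v : V) : G.dist u v < Fintype.card V := by
  obtain ⟨p, hp, hlen⟩ := hG.exists_path_of_dist u v
  exact hlen ▸ hp.length_lt

theorem Connected.exists_adj_dist_eq {V : Type*} {G : SimpleGraph V} (hG : G.Connected)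
    {u w : V} {k : ℕ} (h : G.dist u w = k + 1) : ∃ x, G.Adj u x ∧ G.dist x w = k := by
  obtain ⟨p, hp⟩ := hG.exists_walk_length_eq_dist u w
  cases p with
  | nil => simp at h
  | @cons _ x _ hux q =>
    refine ⟨x, hux, ?_⟩
    have h1 := G.dist_le q
    have h2 := hG.dist_triangle (u := u) (v := x) (w := w)
    rw [dist_eq_one_iff_adj.mpr hux] at h2
    rw [Walk.length_cons] at hp
    omega

theorem Connected.adj_iff_of_injective_dist {V : Type*} {G : SimpleGraph V} (hG : G.Connected)
    {w : V} (hw : Function.Injective fun u => G.dist u w) (u v : V) :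
    G.Adj u v ↔ G.dist u w + 1 = G.dist v w ∨ G.dist v w + 1 = G.dist u w := by
  constructor
  · intro h
    have h1 := hG.dist_triangle (u := u) (v := v) (w := w)
    have h2 := hG.dist_triangle (u := v) (v := u) (w := w)
    rw [dist_eq_one_iff_adj.mpr h] at h1
    rw [dist_eq_one_iff_adj.mpr h.symm] at h2
    have h3 : G.dist u w ≠ G.dist v w := fun h4 => h.ne (hw h4)
    omega
  · rintro (h | h)
    · obtain ⟨x, hx, hxw⟩ := hG.exists_adj_dist_eq h.symm
      exact (hw hxw ▸ hx).symm
    · obtain ⟨x, hx, hxw⟩ := hG.exists_adj_dist_eq h.symm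
      exact hw hxw ▸ hx

theorem Connected.nonempty_iso_pathGraph {V : Type*} [Fintype V] {G : SimpleGraph V}
    (hG : G.Connected) {w : V} (hw : Function.Injective fun u => G.dist u w) :
    Nonempty (G ≃g pathGraph (Fintype.card V)) := by
  let f : V → Fin (Fintype.card V) := fun u => ⟨G.dist u w, hG.dist_lt_card u w⟩
  have hf : Function.Bijective f :=
    (Fintype.bijective_iff_injective_and_card f).mpr
      ⟨fun u v h => hw (Fin.mk.inj h), by simp⟩
  exact ⟨⟨Equiv.ofBijective f hf, fun {u v} =>
    pathGraph_adj.trans (hG.adj_iff_of_injective_dist hw u v).symm⟩⟩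

theorem Walk.val_le_add_length_of_pathGraph {n : ℕ} {i j : Fin n} (p : (pathGraph n).Walk i j) :
    i.val ≤ j.val + p.length := by
  induction p with
  | nil => simp
  | cons h q ih =>
    rw [pathGraph_adj] at h
    rw [Walk.length_cons]
    omega

theorem dist_pathGraph_zero {n : ℕ} (i : Fin (n + 1)) : (pathGraph (n + 1)).dist i 0 = i.val := by
  have hc := pathGraph_connected n
  apply le_antisymm
  · induction i using Fin.induction with
    | zero => simp
    | succ i ih =>
      have h : (pathGraph (n + 1)).Adj i.succ i.castSucc := by simp [pathGraph_adj]
      have ht := hc.dist_triangle (u := i.succ) (v := i.castSucc) (w := 0)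
      rw [dist_eq_one_iff_adj.mpr h] at ht
      simp only [Fin.val_castSucc, Fin.val_succ] at ih ⊢
      omega
  · obtain ⟨p, hp⟩ := hc.exists_walk_length_eq_dist i 0
    simpa [hp] using p.val_le_add_length_of_pathGraph

theorem Connected.dist_map_le {V W : Type*} {G : SimpleGraph V} {H : SimpleGraph W}
    (hG : G.Connected) (f : G →g H) (u v : V) : H.dist (f u) (f v) ≤ G.dist u v := by
  obtain ⟨p, hp⟩ := hG.exists_walk_length_eq_dist u v
  simpa [hp] using H.dist_le (p.map f)

theorem Iso.dist_map_eq {V W : Type*} {G : SimpleGraph V} {H : SimpleGraph W}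
    (hG : G.Connected) (e : G ≃g H) (u v : V) : H.dist (e u) (e v) = G.dist u v := by
  apply le_antisymm (hG.dist_map_le e.toHom u v)
  simpa using (e.connected_iff.mp hG).dist_map_le e.symm.toHom (e u) (e v)

end SimpleGraph

/-- A nontrivial finite connected graph has outer multiset dimension `1` if and only
if it is a path graph. -/
theorem dimMS_eq_one_iff_path
    {V : Type*} [Fintype V] (G : SimpleGraph V)
    (hV : 1 < Fintype.card V) (hG : G.Connected) :
    dimMS G = 1 ↔ ∃ n : ℕ, 2 ≤ n ∧ Nonempty (G ≃g SimpleGraph.pathGraph n) := by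
  have : Nontrivial V := Fintype.one_lt_card_iff_nontrivial.mp hV
  rw [dimMS_eq_one_iff_exists_injective_dist hG]
  constructor
  · rintro ⟨w, hw⟩
    exact ⟨Fintype.card V, hV, hG.nonempty_iso_pathGraph hw⟩
  · rintro ⟨n, hn, ⟨e⟩⟩
    obtain ⟨m, rfl⟩ : ∃ m, n = m + 1 := ⟨n - 1, by omega⟩
    refine ⟨e.symm 0, fun u v huv => e.injective (Fin.ext ?_)⟩
    simpa [← e.dist_map_eq hG, SimpleGraph.dist_pathGraph_zero] using huv
end

section
/- The cycle graph on 4 vertices satisfies dim_ms(C_4) = 3 and the cycle graph on 5 vertices satisfies dim_ms(C_5) = 4. -/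
/-- In a graph where any two distinct non-adjacent vertices have a common neighbour,
every distance is at most two and is determined by equality and adjacency. -/
lemma dist_eq_ite_of_common_neighbor {V : Type*} [DecidableEq V] (G : SimpleGraph V)
    [DecidableRel G.Adj]
    (h : ∀ u v, u ≠ v → ¬ G.Adj u v → ∃ w, G.Adj u w ∧ G.Adj w v) (u v : V) :
    G.dist u v = if u = v then 0 else if G.Adj u v then 1 else 2 := by
  split_ifs with h₁ h₂
  · simp [h₁]
  · exact SimpleGraph.dist_eq_one_iff_adj.mpr h₂
  · obtain ⟨w, huw, hwv⟩ := h u v h₁ h₂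
    let p : G.Walk u v := .cons huw (.cons hwv .nil)
    have hle : G.dist u v ≤ 2 := SimpleGraph.dist_le p
    have hpos : 0 < G.dist u v := p.reachable.pos_dist_of_ne h₁
    have hne : G.dist u v ≠ 1 := fun h₃ ↦ h₂ (SimpleGraph.dist_eq_one_iff_adj.mp h₃)
    omega

lemma dimMS_eq_of_forall_card_le {V : Type*} [Fintype V] {G : SimpleGraph V} {S : Finset V}
    (hS : outerMResolving G S) (h : ∀ T : Finset V, outerMResolving G T → S.card ≤ T.card) :
    dimMS G = S.card :=
  IsLeast.csInf_eq ⟨⟨S, hS, rfl⟩, by rintro _ ⟨T, hT, rfl⟩; exact h T hT⟩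

/-- The complement of a single vertex is outer multiset resolving. -/
lemma outerMResolving_compl_singleton {V : Type*} [Fintype V] [DecidableEq V]
    (G : SimpleGraph V) (x : V) : outerMResolving G {x}ᶜ := by
  intro u v hu hv _
  simp only [Finset.mem_compl, Finset.mem_singleton, not_not] at hu hv
  rw [hu, hv]

lemma three_le_card_of_outerMResolving_cycleGraph_four (S : Finset (Fin 4))
    (hS : outerMResolving (SimpleGraph.cycleGraph 4) S) : 3 ≤ S.card := by
  have hd : (SimpleGraph.cycleGraph 4).dist = _ := funext₂ <|
    dist_eq_ite_of_common_neighbor (SimpleGraph.cycleGraph 4) (by decide)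
  unfold outerMResolving mrep at hS
  rw [hd] at hS
  revert S
  decide

set_option maxRecDepth 10000 in
lemma four_le_card_of_outerMResolving_cycleGraph_five (S : Finset (Fin 5))
    (hS : outerMResolving (SimpleGraph.cycleGraph 5) S) : 4 ≤ S.card := by
  have hd : (SimpleGraph.cycleGraph 5).dist = _ := funext₂ <|
    dist_eq_ite_of_common_neighbor (SimpleGraph.cycleGraph 5) (by decide)
  unfold outerMResolving mrep at hS
  rw [hd] at hS
  revert S
  decide

/-- The cycle `C_4` has outer multiset dimension `3` and the cycle `C_5` has outer
multiset dimension `4`. -/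
theorem dimMS_cycle_four_five :
    dimMS (SimpleGraph.cycleGraph 4) = 3 ∧ dimMS (SimpleGraph.cycleGraph 5) = 4 :=
  ⟨dimMS_eq_of_forall_card_le (outerMResolving_compl_singleton _ (0 : Fin 4))
      three_le_card_of_outerMResolving_cycleGraph_four,
    dimMS_eq_of_forall_card_le (outerMResolving_compl_singleton _ (0 : Fin 5))
      four_le_card_of_outerMResolving_cycleGraph_five⟩
end

section
/- Every cycle graph C_n of order n ≥ 6 satisfies dim_ms(C_n) = 3. -/
namespace SimpleGraph

/-- Adjacency in a cycle graph, in terms of the values of the vertices. -/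
theorem cycleGraph_adj_iff_val {n : ℕ} (hn : 3 ≤ n) (u v : Fin n) :
    (cycleGraph n).Adj u v ↔ u.val + 1 = v.val ∨ v.val + 1 = u.val ∨
      (u.val = 0 ∧ v.val + 1 = n) ∨ (v.val = 0 ∧ u.val + 1 = n) := by
  have hu := u.isLt
  have hv := v.isLt
  rw [cycleGraph_adj']
  rcases lt_trichotomy u v with h | h | h
  · rw [Fin.sub_val_of_le h.le, Fin.coe_sub_iff_lt.2 h]
    rw [Fin.lt_def] at h
    omega
  · subst h
    rw [Fin.sub_val_of_le le_rfl]
    omega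
  · rw [Fin.sub_val_of_le h.le, Fin.coe_sub_iff_lt.2 h]
    rw [Fin.lt_def] at h
    omega

theorem le_length_of_walk_cycleGraph {n : ℕ} (hn : 3 ≤ n) {u v : Fin n}
    (p : (cycleGraph n).Walk u v) :
    min (max u.val v.val - min u.val v.val) (n - (max u.val v.val - min u.val v.val)) ≤
      p.length := by
  induction p with
  | nil => simp
  | @cons a b c h p ih =>
    rw [cycleGraph_adj_iff_val hn] at h
    rw [Walk.length_cons]
    have ha := a.isLt
    have hb := b.isLt
    have hc := c.isLt
    omega

theorem dist_cycleGraph_le {n : ℕ} (hn : 3 ≤ n) (d : ℕ) (u v : Fin n)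
    (h : min (max u.val v.val - min u.val v.val)
      (n - (max u.val v.val - min u.val v.val)) ≤ d) :
    (cycleGraph n).dist u v ≤ d := by
  have hconn : (cycleGraph n).Connected := by
    obtain ⟨m, rfl⟩ : ∃ m, n = m + 1 := ⟨n - 1, by omega⟩
    exact cycleGraph_connected
  induction d generalizing u with
  | zero =>
    have : u = v := by
      ext
      omega
    simp [this]
  | succ d ih =>
    have hu := u.isLt
    have hv := v.isLt
    by_cases huv : u = v
    · simp [huv]
    have huv' : u.val ≠ v.val := fun h => huv (Fin.ext h)
    obtain ⟨w, hw, hadj, hwd⟩ : ∃ w, ∃ _ : w < n, (u.val + 1 = w ∨ w + 1 = u.val ∨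
        (u.val = 0 ∧ w + 1 = n) ∨ (w = 0 ∧ u.val + 1 = n)) ∧
        min (max w v.val - min w v.val) (n - (max w v.val - min w v.val)) ≤ d := by
      by_cases hup : (u.val < v.val ∧ 2 * (v.val - u.val) ≤ n) ∨
          (v.val < u.val ∧ n < 2 * (u.val - v.val))
      · by_cases hlast : u.val + 1 = n
        · exact ⟨0, by omega, by omega, by omega⟩
        · exact ⟨u.val + 1, by omega, by omega, by omega⟩
      · by_cases hfirst : u.val = 0
        · exact ⟨n - 1, by omega, by omega, by omega⟩
        · exact ⟨u.val - 1, by omega, by omega, by omega⟩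
    have h₁ : (cycleGraph n).dist u ⟨w, hw⟩ = 1 :=
      dist_eq_one_iff_adj.2 ((cycleGraph_adj_iff_val hn _ _).2 hadj)
    have h₂ := ih ⟨w, hw⟩ hwd
    have h₃ := hconn.dist_triangle (u := u) (v := ⟨w, hw⟩) (w := v)
    omega

/-- The distance between two vertices of a cycle graph. -/
theorem dist_cycleGraph {n : ℕ} (hn : 3 ≤ n) (u v : Fin n) :
    (cycleGraph n).dist u v =
      min (max u.val v.val - min u.val v.val) (n - (max u.val v.val - min u.val v.val)) := by
  refine le_antisymm (dist_cycleGraph_le hn _ u v le_rfl) ?_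
  obtain ⟨p, hp⟩ := (cycleGraph_preconnected u v).exists_walk_length_eq_dist
  rw [← hp]
  exact le_length_of_walk_cycleGraph hn p

/-- The reflection of a cycle swapping two given vertices moves a vertex other than these. -/
theorem exists_reflection_cycleGraph {n : ℕ} (hn : 6 ≤ n) (a b : Fin n) :
    ∃ x y : Fin n, x ≠ y ∧ (x ≠ a ∧ x ≠ b) ∧ (y ≠ a ∧ y ≠ b) ∧
      (cycleGraph n).dist x a = (cycleGraph n).dist y b ∧
      (cycleGraph n).dist x b = (cycleGraph n).dist y a := by
  obtain ⟨a, ha⟩ := a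
  obtain ⟨b, hb⟩ := b
  obtain ⟨x, hx, hxa, hxb, h⟩ : ∃ x < 6, x ≠ a ∧ x ≠ b ∧
      (2 * x ≠ a + b ∧ 2 * x ≠ a + b + n ∧ 2 * x + n ≠ a + b) := by
    by_contra! hcon
    have h0 := hcon 0
    have h1 := hcon 1
    have h2 := hcon 2
    have h3 := hcon 3
    have h4 := hcon 4
    have h5 := hcon 5
    omega
  obtain ⟨y, hy, hxy⟩ : ∃ y < n, x + y = a + b ∨ x + y = a + b + n ∨ x + y + n = a + b := by
    by_cases h₁ : a + b < x
    · exact ⟨a + b + n - x, by omega, by omega⟩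
    · by_cases h₂ : a + b < x + n
      · exact ⟨a + b - x, by omega, by omega⟩
      · exact ⟨a + b - x - n, by omega, by omega⟩
  refine ⟨⟨x, by omega⟩, ⟨y, hy⟩, ?_⟩
  simp only [ne_eq, Fin.mk.injEq, dist_cycleGraph (show 3 ≤ n by omega)]
  refine ⟨by omega, by omega, by omega, ?_, ?_⟩ <;> omega

end SimpleGraph

theorem three_le_card_of_outerMResolving_cycleGraph {n : ℕ} (hn : 6 ≤ n) {S : Finset (Fin n)}
    (hS : outerMResolving (SimpleGraph.cycleGraph n) S) : 3 ≤ S.card := by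
  by_contra! hcard
  obtain h0 | h1 | h2 : S.card = 0 ∨ S.card = 1 ∨ S.card = 2 := by omega
  · rw [Finset.card_eq_zero] at h0
    subst h0
    have := hS ⟨0, by omega⟩ ⟨1, by omega⟩ (by simp) (by simp) (by simp [mrep])
    simp at this
  · obtain ⟨a, rfl⟩ := Finset.card_eq_one.1 h1
    obtain ⟨x, y, hxy, hx, hy, h, -⟩ := SimpleGraph.exists_reflection_cycleGraph hn a a
    exact hxy (hS x y (by simp [hx]) (by simp [hy]) (by simp [mrep, h]))
  · obtain ⟨a, b, hab, rfl⟩ := Finset.card_eq_two.1 h2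
    obtain ⟨x, y, hxy, hx, hy, h, h'⟩ := SimpleGraph.exists_reflection_cycleGraph hn a b
    refine hxy (hS x y (by simp [hx]) (by simp [hy]) ?_)
    simpa [mrep, Finset.insert_val_of_notMem (Finset.notMem_singleton.2 hab), h, h'] using
      Multiset.pair_comm _ _

theorem min_max_sum_eq_of_triple_eq {a b c d e f : ℕ}
    (h : a ::ₘ b ::ₘ {c} = d ::ₘ e ::ₘ ({f} : Multiset ℕ)) :
    ∃ m M s, (min (min a b) c = m ∧ max (max a b) c = M ∧ a + (b + c) = s) ∧
      (min (min d e) f = m ∧ max (max d e) f = M ∧ d + (e + f) = s) := by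
  have hsum := congrArg Multiset.sum h
  have hmem (k : ℕ) := congrArg (k ∈ ·) h
  simp only [Multiset.sum_cons, Multiset.sum_singleton] at hsum
  simp only [Multiset.mem_cons, Multiset.mem_singleton, eq_iff_iff] at hmem
  have ha := (hmem a).1 (Or.inl rfl)
  have hb := (hmem b).1 (Or.inr (Or.inl rfl))
  have hc := (hmem c).1 (Or.inr (Or.inr rfl))
  have hd := (hmem d).2 (Or.inl rfl)
  have he := (hmem e).2 (Or.inr (Or.inl rfl))
  have hf := (hmem f).2 (Or.inr (Or.inr rfl))
  clear hmem h
  refine ⟨_, _, _, ⟨?_, ?_, hsum⟩, rfl, rfl, rfl⟩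
  · apply le_antisymm <;> simp only [le_min_iff, min_le_iff] <;> omega
  · apply le_antisymm <;> simp only [max_le_iff, le_max_iff] <;> omega

/-- The least, the greatest and the sum of the distances from the vertex `x` of a cycle to the
vertices `0`, `1` and `3`, by the position of `x`. -/
theorem cycle_distances_min_max_sum {n x p q r m M s : ℕ} (hn : 6 ≤ n) (hx : x < n)
    (h0 : x ≠ 0) (h1 : x ≠ 1) (h3 : x ≠ 3)
    (hp : min (max x 0 - min x 0) (n - (max x 0 - min x 0)) = p)
    (hq : min (max x 1 - min x 1) (n - (max x 1 - min x 1)) = q)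
    (hr : min (max x 3 - min x 3) (n - (max x 3 - min x 3)) = r)
    (hm : min (min p q) r = m) (hM : max (max p q) r = M) (hs : p + (q + r) = s) :
    (x = 2 ∧ m = 1 ∧ M = 2 ∧ s = 4) ∨
      (4 ≤ x ∧ 2 * x ≤ n ∧ m + 3 = x ∧ M = x ∧ s + 4 = 3 * x) ∨
      (4 ≤ x ∧ 2 * x = n + 1 ∧ m + 3 = x ∧ M + 1 = x ∧ s + 5 = 3 * x) ∨
      (4 ≤ x ∧ 2 * x = n + 2 ∧ m + 3 = x ∧ M + 1 = x ∧ s + 6 = 3 * x) ∨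
      (4 ≤ x ∧ 2 * x = n + 3 ∧ m + 3 = x ∧ M + 2 = x ∧ s + 8 = 3 * x) ∨
      (2 * x = n + 4 ∧ m + 4 = x ∧ M + 3 = x ∧ s + 10 = 3 * x) ∨
      (2 * x = n + 5 ∧ m + 5 = x ∧ M + 3 = x ∧ s + 12 = 3 * x) ∨
      (n + 6 ≤ 2 * x ∧ m + x = n ∧ M + x = n + 3 ∧ s + 3 * x = 3 * n + 4) := by
  revert hm hM hs
  obtain rfl | h4 : x = 2 ∨ 4 ≤ x := by omega
  · obtain ⟨rfl, rfl, rfl⟩ : p = 2 ∧ q = 1 ∧ r = 1 := by omega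
    exact fun hm hM hs => Or.inl (by omega)
  replace hp : min x (n - x) = p := by omega
  replace hq : min (x - 1) (n + 1 - x) = q := by omega
  replace hr : min (x - 3) (n + 3 - x) = r := by omega
  obtain h | h | h | h | h | h | h : 2 * x ≤ n ∨ 2 * x = n + 1 ∨ 2 * x = n + 2 ∨ 2 * x = n + 3 ∨
      2 * x = n + 4 ∨ 2 * x = n + 5 ∨ n + 6 ≤ 2 * x := by omega
  · have : p = x ∧ q + 1 = x ∧ r + 3 = x := by omega
    clear hp hq hr
    intro hm hM hs
    exact Or.inr <| Or.inl (by omega)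
  · have : p + 1 = x ∧ q + 1 = x ∧ r + 3 = x := by omega
    clear hp hq hr
    intro hm hM hs
    exact Or.inr <| Or.inr <| Or.inl (by omega)
  · have : p + 2 = x ∧ q + 1 = x ∧ r + 3 = x := by omega
    clear hp hq hr
    intro hm hM hs
    exact Or.inr <| Or.inr <| Or.inr <| Or.inl (by omega)
  · have : p + 3 = x ∧ q + 2 = x ∧ r + 3 = x := by omega
    clear hp hq hr
    intro hm hM hs
    exact Or.inr <| Or.inr <| Or.inr <| Or.inr <| Or.inl (by omega)
  · have : p + 4 = x ∧ q + 3 = x ∧ r + 3 = x := by omega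
    clear hp hq hr
    intro hm hM hs
    exact Or.inr <| Or.inr <| Or.inr <| Or.inr <| Or.inr <| Or.inl (by omega)
  · have : p + 5 = x ∧ q + 4 = x ∧ r + 3 = x := by omega
    clear hp hq hr
    intro hm hM hs
    exact Or.inr <| Or.inr <| Or.inr <| Or.inr <| Or.inr <| Or.inr <| Or.inl (by omega)
  · have : p + x = n ∧ q + x = n + 1 ∧ r + x = n + 3 := by omega
    clear hp hq hr
    intro hm hM hs
    iterate 7 refine Or.inr ?_
    omega

theorem outerMResolving_cycleGraph {n : ℕ} (hn : 6 ≤ n) :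
    outerMResolving (SimpleGraph.cycleGraph n)
      ({⟨0, by omega⟩, ⟨1, by omega⟩, ⟨3, by omega⟩} : Finset (Fin n)) := by
  rintro ⟨x, hxn⟩ ⟨y, hyn⟩ hx hy h
  simp only [Finset.mem_insert, Finset.mem_singleton, Fin.mk.injEq, not_or] at hx hy
  rw [mrep, mrep, Finset.insert_val_of_notMem (by simp), Finset.insert_val_of_notMem (by simp)]
    at h
  simp only [Finset.singleton_val, Multiset.map_cons, Multiset.map_singleton,
    SimpleGraph.dist_cycleGraph (show 3 ≤ n by omega)] at h
  rw [Fin.mk.injEq]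
  obtain ⟨m, M, s, ⟨hm, hM, hs⟩, hm', hM', hs'⟩ := min_max_sum_eq_of_triple_eq h
  have hx' := cycle_distances_min_max_sum hn hxn hx.1 hx.2.1 hx.2.2 rfl rfl rfl hm hM hs
  have hy' := cycle_distances_min_max_sum hn hyn hy.1 hy.2.1 hy.2.2 rfl rfl rfl hm' hM' hs'
  clear h hm hM hs hm' hM' hs'
  omega

/-- Every cycle graph `C_n` with `n ≥ 6` has outer multiset dimension `3`. -/
theorem dimMS_cycleGraph (n : ℕ) (hn : 6 ≤ n) :
    dimMS (SimpleGraph.cycleGraph n) = 3 := by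
  have hmem : 3 ∈ {k | ∃ S : Finset (Fin n),
      outerMResolving (SimpleGraph.cycleGraph n) S ∧ S.card = k} :=
    ⟨_, outerMResolving_cycleGraph hn, by
      rw [Finset.card_eq_three]
      exact ⟨_, _, _, by simp, by simp, by simp, rfl⟩⟩
  refine le_antisymm (Nat.sInf_le hmem) (le_csInf ⟨3, hmem⟩ ?_)
  rintro k ⟨S, hS, rfl⟩
  exact three_le_card_of_outerMResolving_cycleGraph hn hS
end

section
/- Let G be a nontrivial finite simple connected graph of order n and diameter d, and let S be an outer multiset resolving set of G of cardinality r. Then the number of multisets of size r with elements in {1, 2, …, d} is at least n − r; that is, C(r + d − 1, d − 1) ≥ n − r. Consequently dim_ms(G) ≥ f'(n,d), where f'(n,d) is the smallest positive integer k such that k + C(k + d − 1, d − 1) ≥ n. -/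
/-- The diameter of a finite graph: the largest distance between two vertices. -/
noncomputable def gdiam {V : Type*} [Fintype V] (G : SimpleGraph V) : ℕ :=
  Finset.univ.sup fun p : V × V => G.dist p.1 p.2

/-- `f'(n,d)`: the smallest positive integer `k` such that `k + C(k+d-1, d-1) ≥ n`. -/
noncomputable def fprime (n d : ℕ) : ℕ :=
  sInf {k | 0 < k ∧ n ≤ k + (k + d - 1).choose (d - 1)}

lemma dist_le_gdiam {V : Type*} [Fintype V] (G : SimpleGraph V) (u v : V) :
    G.dist u v ≤ gdiam G :=
  Finset.le_sup (f := fun p : V × V => G.dist p.1 p.2) (Finset.mem_univ (u, v))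

lemma gdiam_pos {V : Type*} [Fintype V] {G : SimpleGraph V} (hG : G.Connected)
    (hV : 1 < Fintype.card V) : 0 < gdiam G := by
  obtain ⟨u, v, huv⟩ := Fintype.one_lt_card_iff.mp hV
  exact (hG.pos_dist_of_ne huv).trans_le (dist_le_gdiam G u v)

lemma card_sym_fin {d : ℕ} (hd : 0 < d) (r : ℕ) :
    Fintype.card (Sym (Fin d) r) = (r + d - 1).choose (d - 1) := by
  rw [Sym.card_sym_eq_choose, Fintype.card_fin, Nat.add_comm d r]
  exact (Nat.choose_symm_of_eq_add (by omega)).symm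

/-- Shifting down by one the distances from a vertex outside `S` embeds the complement of `S`
into the multisets of size `|S|` over `Fin d`. -/
lemma outerMResolving.card_sub_le {V : Type*} [Fintype V] {G : SimpleGraph V}
    (hG : G.Connected) (hV : 1 < Fintype.card V) {S : Finset V} (hS : outerMResolving G S) :
    Fintype.card V - S.card ≤ (S.card + gdiam G - 1).choose (gdiam G - 1) := by
  classical
  have hd := gdiam_pos hG hV
  have : NeZero (gdiam G) := ⟨hd.ne'⟩
  let f : V → Sym (Fin (gdiam G)) S.card := fun u =>
    ⟨S.val.map fun w => Fin.ofNat (gdiam G) (G.dist u w - 1), by simp⟩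
  have hf : ∀ u, u ∉ S → (f u).1.map (fun i => i.val + 1) = mrep G u S := by
    intro u hu
    simp only [f, mrep, Multiset.map_map]
    refine Multiset.map_congr rfl fun w hw => ?_
    have hpos : 0 < G.dist u w := hG.pos_dist_of_ne fun h => hu (h ▸ hw)
    have hle := dist_le_gdiam G u w
    simp only [Function.comp_apply, Fin.val_ofNat]
    rw [Nat.mod_eq_of_lt (by omega)]
    omega
  rw [← card_sym_fin hd, ← Finset.card_compl]
  refine Finset.card_le_card_of_injOn f (fun _ _ => Finset.mem_univ _) ?_
  intro u hu v hv huv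
  have hu : u ∉ S := by simpa using hu
  have hv : v ∉ S := by simpa using hv
  exact hS u v hu hv (by rw [← hf u hu, ← hf v hv, huv])

lemma outerMResolving.card_pos {V : Type*} [Fintype V] {G : SimpleGraph V}
    (hV : 1 < Fintype.card V) {S : Finset V} (hS : outerMResolving G S) : 0 < S.card := by
  obtain ⟨u, v, huv⟩ := Fintype.one_lt_card_iff.mp hV
  rw [Finset.card_pos, Finset.nonempty_iff_ne_empty]
  rintro rfl
  exact huv (hS u v (by simp) (by simp) (by simp [mrep]))

/-- In a nontrivial finite connected graph `G` of order `n` and diameter `d`,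
any outer multiset resolving set `S` of cardinality `r` satisfies
`C(r+d-1, d-1) ≥ n - r`; consequently `dim_ms(G) ≥ f'(n,d)`. -/
theorem dimMS_ge_fprime
    {V : Type*} [Fintype V] (G : SimpleGraph V) (n d r : ℕ)
    (hn : n = Fintype.card V) (hV : 1 < Fintype.card V) (hG : G.Connected)
    (hd : d = gdiam G)
    (S : Finset V) (hS : outerMResolving G S) (hr : r = S.card) :
    n - r ≤ (r + d - 1).choose (d - 1) ∧ fprime n d ≤ dimMS G := by
  subst hn hd hr
  refine ⟨hS.card_sub_le hG hV, ?_⟩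
  obtain ⟨T, hT, hcard⟩ :
      dimMS G ∈ {k | ∃ S : Finset V, outerMResolving G S ∧ S.card = k} :=
    Nat.sInf_mem ⟨S.card, S, hS, rfl⟩
  rw [← hcard]
  refine Nat.sInf_le ⟨hT.card_pos hV, ?_⟩
  have := hT.card_sub_le hG hV
  omega
end

section
/- Let G be a nontrivial finite simple connected graph and let [u_1], [u_2], …, [u_t] be the equivalence classes of V(G) under the twin equivalence relation (u is equivalent to v iff u = v or u and v are twins). Then dim_ms(G) ≥ Σ_{i=1}^{t} (|[u_i]| − 1). -/
/-- The twin equivalence class of a vertex `v`: all vertices `u` with `u = v`, or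
`N(u) = N(v)` (false twins), or `N[u] = N[v]` (true twins). -/
def twinClass {V : Type*} [Fintype V] [DecidableEq V]
    (G : SimpleGraph V) [DecidableRel G.Adj] (v : V) : Finset V :=
  Finset.univ.filter fun u =>
    u = v ∨ G.neighborFinset u = G.neighborFinset v ∨
      insert u (G.neighborFinset u) = insert v (G.neighborFinset v)

open SimpleGraph in
/-- Twins are exactly the pairs with the same adjacencies to every other vertex. -/
theorem mem_twinClass_iff {V : Type*} [Fintype V] [DecidableEq V] (G : SimpleGraph V)
    [DecidableRel G.Adj] {u v : V} :
    u ∈ twinClass G v ↔ ∀ w, w ≠ u → w ≠ v → (G.Adj u w ↔ G.Adj v w) := by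
  simp only [twinClass, Finset.mem_filter, Finset.mem_univ, true_and, Finset.ext_iff,
    Finset.mem_insert, mem_neighborFinset]
  constructor
  · rintro (rfl | h | h) w hu hv
    · rfl
    · exact h w
    · simpa [hu, hv] using h w
  · intro h
    by_cases huv : u = v
    · exact Or.inl huv
    · right
      have hu := G.loopless.irrefl u
      have hv := G.loopless.irrefl v
      have hc := G.adj_comm u v
      by_cases ha : G.Adj u v
      · right
        intro w
        have := h w
        by_cases h1 : w = u
        · subst h1; tauto
        · by_cases h2 : w = v
          · subst h2; tauto
          · tauto
      · left
        intro w
        have := h w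
        by_cases h1 : w = u
        · subst h1; tauto
        · by_cases h2 : w = v
          · subst h2; tauto
          · tauto

theorem mem_twinClass_self {V : Type*} [Fintype V] [DecidableEq V] (G : SimpleGraph V)
    [DecidableRel G.Adj] (v : V) : v ∈ twinClass G v := by
  simp [twinClass]

theorem mem_twinClass_symm {V : Type*} [Fintype V] [DecidableEq V] {G : SimpleGraph V}
    [DecidableRel G.Adj] {u v : V} (h : u ∈ twinClass G v) : v ∈ twinClass G u := by
  rw [mem_twinClass_iff] at *
  exact fun w hv hu => (h w hu hv).symm

theorem mem_twinClass_trans {V : Type*} [Fintype V] [DecidableEq V] {G : SimpleGraph V}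
    [DecidableRel G.Adj] {u v w : V} (huv : u ∈ twinClass G v) (hvw : v ∈ twinClass G w) :
    u ∈ twinClass G w := by
  by_cases h₁ : u = v
  · rwa [h₁]
  by_cases h₂ : v = w
  · rwa [← h₂]
  rw [mem_twinClass_iff] at *
  intro x hxu hxw
  by_cases hxv : x = v
  · subst hxv
    by_cases h₃ : u = w
    · rw [h₃]
    · rw [G.adj_comm u x, hvw u (Ne.symm hxu) h₃, G.adj_comm w u,
        huv w (Ne.symm h₃) (Ne.symm hxw), G.adj_comm x w]
  · exact (huv x hxu hxv).trans (hvw x hxv hxw)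

theorem twinClass_eq_of_mem {V : Type*} [Fintype V] [DecidableEq V] {G : SimpleGraph V}
    [DecidableRel G.Adj] {u v : V} (h : u ∈ twinClass G v) : twinClass G u = twinClass G v := by
  ext x
  exact ⟨fun hx => mem_twinClass_trans hx h, fun hx => mem_twinClass_trans hx (mem_twinClass_symm h)⟩

theorem dist_map_le {V W : Type*} {G : SimpleGraph V} {H : SimpleGraph W} (hG : G.Connected)
    (f : G →g H) (a b : V) : H.dist (f a) (f b) ≤ G.dist a b := by
  obtain ⟨p, hp⟩ := hG.exists_walk_length_eq_dist a b
  rw [← hp, ← SimpleGraph.Walk.length_map f p]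
  exact SimpleGraph.dist_le _

/-- Exchanging two twins is a graph homomorphism. -/
theorem adj_swap_of_mem_twinClass {V : Type*} [Fintype V] [DecidableEq V] {G : SimpleGraph V}
    [DecidableRel G.Adj] {u v : V} (h : u ∈ twinClass G v) {a b : V} (hab : G.Adj a b) :
    G.Adj (Equiv.swap u v a) (Equiv.swap u v b) := by
  rw [mem_twinClass_iff] at h
  have := h a
  have := h b
  have := G.adj_comm
  have := G.ne_of_adj hab
  simp only [Equiv.swap_apply_def]
  grind

theorem dist_le_of_mem_twinClass {V : Type*} [Fintype V] [DecidableEq V] {G : SimpleGraph V}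
    [DecidableRel G.Adj] (hG : G.Connected) {u v w : V} (h : u ∈ twinClass G v)
    (hu : w ≠ u) (hv : w ≠ v) : G.dist v w ≤ G.dist u w := by
  simpa [Equiv.swap_apply_of_ne_of_ne hu hv] using
    dist_map_le hG (⟨Equiv.swap u v, adj_swap_of_mem_twinClass h⟩ : G →g G) u w

theorem mrep_eq_of_mem_twinClass {V : Type*} [Fintype V] [DecidableEq V] {G : SimpleGraph V}
    [DecidableRel G.Adj] (hG : G.Connected) {u v : V} (h : u ∈ twinClass G v) {S : Finset V}
    (hu : u ∉ S) (hv : v ∉ S) : mrep G u S = mrep G v S := by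
  refine Multiset.map_congr rfl fun w hw => ?_
  have hwu : w ≠ u := fun e => hu (e ▸ hw)
  have hwv : w ≠ v := fun e => hv (e ▸ hw)
  exact le_antisymm (dist_le_of_mem_twinClass hG (mem_twinClass_symm h) hwv hwu)
    (dist_le_of_mem_twinClass hG h hwu hwv)

theorem card_twinClass_sub_one_le {V : Type*} [Fintype V] [DecidableEq V] {G : SimpleGraph V}
    [DecidableRel G.Adj] (hG : G.Connected) {S : Finset V} (hS : outerMResolving G S) (v : V) :
    (twinClass G v).card - 1 ≤ (twinClass G v ∩ S).card := by
  have h : (twinClass G v \ S).card ≤ 1 := by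
    refine Finset.card_le_one.2 fun a ha b hb => ?_
    rw [Finset.mem_sdiff] at ha hb
    exact hS a b ha.2 hb.2 (mrep_eq_of_mem_twinClass hG
      (mem_twinClass_trans ha.1 (mem_twinClass_symm hb.1)) ha.2 hb.2)
  have := Finset.card_sdiff_add_card_inter (twinClass G v) S
  omega

theorem pairwiseDisjoint_twinClass {V : Type*} [Fintype V] [DecidableEq V] (G : SimpleGraph V)
    [DecidableRel G.Adj] :
    (↑(Finset.univ.image (twinClass G)) : Set (Finset V)).PairwiseDisjoint id := by
  intro c hc d hd hcd
  simp only [Finset.coe_image, Finset.coe_univ, Set.image_univ, Set.mem_range] at hc hd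
  obtain ⟨u, rfl⟩ := hc
  obtain ⟨v, rfl⟩ := hd
  refine Finset.disjoint_left.2 fun x hx hy => hcd ?_
  exact (twinClass_eq_of_mem hx).symm.trans (twinClass_eq_of_mem hy)

theorem exists_outerMResolving_card_eq_dimMS {V : Type*} [Fintype V] (G : SimpleGraph V) :
    ∃ S : Finset V, outerMResolving G S ∧ S.card = dimMS G :=
  Nat.sInf_mem (s := {k | ∃ S : Finset V, outerMResolving G S ∧ S.card = k})
    ⟨_, Finset.univ, fun u _ hu => absurd (Finset.mem_univ u) hu, rfl⟩

/-- For a nontrivial finite connected graph, the outer multiset dimension is at least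
the sum, over the equivalence classes of the twin relation, of (size of class − 1). -/
theorem dimMS_ge_sum_twinClasses
    {V : Type*} [Fintype V] [DecidableEq V] (G : SimpleGraph V) [DecidableRel G.Adj]
    (hV : 1 < Fintype.card V) (hG : G.Connected) :
    ∑ c ∈ Finset.univ.image (twinClass G), (c.card - 1) ≤ dimMS G := by
  obtain ⟨S, hS, hcard⟩ := exists_outerMResolving_card_eq_dimMS G
  rw [← hcard]
  calc ∑ c ∈ Finset.univ.image (twinClass G), (c.card - 1)
      ≤ ∑ c ∈ Finset.univ.image (twinClass G), (c ∩ S).card := by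
        refine Finset.sum_le_sum fun c hc => ?_
        obtain ⟨v, -, rfl⟩ := Finset.mem_image.1 hc
        exact card_twinClass_sub_one_le hG hS v
    _ = ((Finset.univ.image (twinClass G)).biUnion fun c => c ∩ S).card := by
        refine (Finset.card_biUnion fun c hc d hd hcd => ?_).symm
        exact (pairwiseDisjoint_twinClass G hc hd hcd).mono
          Finset.inter_subset_left Finset.inter_subset_left
    _ ≤ S.card :=
        Finset.card_le_card (Finset.biUnion_subset.2 fun _ _ => Finset.inter_subset_right)
end
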